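/- Let d ≥ 1, m ≥ 1 be integers, 0 ≤ θ < d, and let a ∈ C^m(ℝ^d \ {0}) satisfy |∂^α a(x)| ≤ M |x|^{−θ−|α|} for all |α| ≤ m and x ≠ 0. Then there is a constant C = C(d, m, θ) such that for all t > 0, x ∈ ℝ^d and |α| ≤ m, |∂_x^α (e^{tΔ}a)(x)| ≤ C M (√t + |x|)^{−θ−|α|}, where e^{tΔ}a = g_t * a is the heat semigroup applied to a. -/

import Mathlib

open scoped BigOperators

/-- Partial derivative in direction `i`. -/
noncomputable def pd {d : ℕ} (i : Fin d) (f : EuclideanSpace ℝ (Fin d) → ℝ) :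
    EuclideanSpace ℝ (Fin d) → ℝ :=
  fun x => fderiv ℝ f x (EuclideanSpace.single i 1)

/-- The multi-index partial derivative `∂^α f`. -/
noncomputable def multiDeriv {d : ℕ} (α : Fin d → ℕ) (f : EuclideanSpace ℝ (Fin d) → ℝ) :
    EuclideanSpace ℝ (Fin d) → ℝ :=
  (List.finRange d).foldl (fun g i => (pd i)^[α i] g) f

/-- The heat kernel `g_t(y) = (4πt)^{−d/2} e^{−|y|²/(4t)}` on `ℝ^d`. -/
noncomputable def heatKernel (d : ℕ) (t : ℝ) (y : EuclideanSpace ℝ (Fin d)) : ℝ :=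
  (4 * Real.pi * t) ^ (-(d : ℝ) / 2) * Real.exp (-‖y‖ ^ 2 / (4 * t))

/-- The heat semigroup `e^{tΔ}a = g_t * a`. -/
noncomputable def heat (d : ℕ) (t : ℝ) (a : EuclideanSpace ℝ (Fin d) → ℝ) :
    EuclideanSpace ℝ (Fin d) → ℝ :=
  fun x => ∫ y : EuclideanSpace ℝ (Fin d), heatKernel d t (x - y) * a y

open MeasureTheory Filter Topology

/-- The composition of the partial derivatives along a list of directions, the head of the list
being applied first. -/
noncomputable def listDeriv {d : ℕ} (L : List (Fin d)) (f : EuclideanSpace ℝ (Fin d) → ℝ) :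
    EuclideanSpace ℝ (Fin d) → ℝ :=
  L.foldl (fun g i => pd i g) f

section PartialDerivatives

variable {d : ℕ}

local notation "𝔼" => EuclideanSpace ℝ (Fin d)

lemma listDeriv_cons (i : Fin d) (L : List (Fin d)) (f : 𝔼 → ℝ) :
    listDeriv (i :: L) f = listDeriv L (pd i f) := rfl

lemma listDeriv_append (L L' : List (Fin d)) (f : 𝔼 → ℝ) :
    listDeriv (L ++ L') f = listDeriv L' (listDeriv L f) := List.foldl_append

lemma listDeriv_replicate (n : ℕ) (i : Fin d) (f : 𝔼 → ℝ) :
    listDeriv (List.replicate n i) f = (pd i)^[n] f := by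
  induction n generalizing f with
  | zero => rfl
  | succ n ih => rw [List.replicate_succ, listDeriv_cons, ih, Function.iterate_succ_apply]

/-- The sorted list of directions that corresponds to a multi-index. -/
def multiIndexList (α : Fin d → ℕ) : List (Fin d) :=
  (List.finRange d).flatMap fun i => List.replicate (α i) i

lemma multiDeriv_eq_listDeriv (α : Fin d → ℕ) (f : 𝔼 → ℝ) :
    multiDeriv α f = listDeriv (multiIndexList α) f := by
  unfold multiDeriv multiIndexList
  induction List.finRange d generalizing f with
  | nil => rfl
  | cons i l ih =>
    rw [List.foldl_cons, ih, List.flatMap_cons, listDeriv_append, listDeriv_replicate]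

lemma length_multiIndexList (α : Fin d → ℕ) : (multiIndexList α).length = ∑ j, α j := by
  simp [multiIndexList, List.length_flatMap, List.finRange_eq_pmap_range,
    Fin.sum_univ_def]

lemma count_multiIndexList (α : Fin d → ℕ) (i : Fin d) : (multiIndexList α).count i = α i := by
  rw [multiIndexList, List.count_flatMap, ← Fin.sum_univ_def]
  simp [List.count_replicate]

lemma perm_multiIndexList (L : List (Fin d)) : L.Perm (multiIndexList fun i => L.count i) :=
  List.perm_iff_count.2 fun i =>
    (count_multiIndexList (fun i => L.count i) i).symm

lemma pd_congr {f g : 𝔼 → ℝ} {x : 𝔼} (h : f =ᶠ[𝓝 x] g) (i : Fin d) : pd i f =ᶠ[𝓝 x] pd i g :=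
  (h.fderiv (𝕜 := ℝ)).mono fun y hy => by simp only [pd, hy]

lemma listDeriv_congr {f g : 𝔼 → ℝ} {x : 𝔼} (L : List (Fin d)) (h : f =ᶠ[𝓝 x] g) :
    listDeriv L f =ᶠ[𝓝 x] listDeriv L g := by
  induction L generalizing f g with
  | nil => exact h
  | cons i L ih => exact ih (pd_congr h i)

lemma ContDiffAt.pd {n : ℕ} {f : 𝔼 → ℝ} {x : 𝔼} (hf : ContDiffAt ℝ (n + 1 : ℕ) f x)
    (i : Fin d) : ContDiffAt ℝ n (pd i f) x :=
  (hf.fderiv_right (m := n) (by norm_cast)).clm_apply contDiffAt_const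

lemma ContDiff.pd {n : ℕ} {f : 𝔼 → ℝ} (hf : ContDiff ℝ (n + 1 : ℕ) f) (i : Fin d) :
    ContDiff ℝ n (pd i f) :=
  contDiff_iff_contDiffAt.2 fun _ => hf.contDiffAt.pd i

lemma pd_pd_comm {f : 𝔼 → ℝ} {x : 𝔼} (hf : ContDiffAt ℝ 2 f x) (i j : Fin d) :
    pd i (pd j f) x = pd j (pd i f) x := by
  have key : ∀ i j : Fin d, pd i (pd j f) x =
      fderiv ℝ (fderiv ℝ f) x (EuclideanSpace.single i 1) (EuclideanSpace.single j 1) := by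
    intro i j
    have h : DifferentiableAt ℝ (fderiv ℝ f) x :=
      (hf.fderiv_right (m := 1) (by norm_num)).differentiableAt one_ne_zero
    change fderiv ℝ (fun y => fderiv ℝ f y (EuclideanSpace.single j 1)) x _ = _
    rw [fderiv_clm_apply h (differentiableAt_const _)]
    simp
  rw [key, key]
  exact hf.isSymmSndFDerivAt (by simp) _ _

lemma listDeriv_perm {L L' : List (Fin d)} (h : L.Perm L') {f : 𝔼 → ℝ} {x : 𝔼}
    (hf : ContDiffAt ℝ L.length f x) : listDeriv L f x = listDeriv L' f x := by
  induction h generalizing f with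
  | nil => rfl
  | cons i _ ih => exact ih (hf.pd i)
  | swap i j L =>
    refine (listDeriv_congr L ?_).eq_of_nhds
    have h2 : ContDiffAt ℝ 2 f x := hf.of_le (by
      simp only [List.length_cons]; push_cast; rw [add_assoc, one_add_one_eq_two]; simp)
    exact (h2.eventually (by simp)).mono fun y hy => pd_pd_comm hy i j
  | trans h₁ _ ih₁ ih₂ => rw [ih₁ hf, ih₂ (by rwa [← h₁.length_eq])]

lemma norm_iteratedFDeriv_pd_le {n : ℕ} {f : 𝔼 → ℝ} {x : 𝔼}
    (hf : ContDiffAt ℝ (n + 1 : ℕ) f x) (i : Fin d) :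
    ‖iteratedFDeriv ℝ n (pd i f) x‖ ≤ ‖iteratedFDeriv ℝ (n + 1) f x‖ := by
  have h := norm_iteratedFDeriv_clm_apply_const (c := EuclideanSpace.single i (1 : ℝ))
    (hf.fderiv_right (m := n) (by norm_cast)) le_rfl
  rwa [norm_iteratedFDeriv_fderiv, PiLp.norm_single, norm_one, one_mul] at h

lemma abs_listDeriv_le {L : List (Fin d)} {f : 𝔼 → ℝ} {x : 𝔼}
    (hf : ContDiffAt ℝ L.length f x) :
    |listDeriv L f x| ≤ ‖iteratedFDeriv ℝ L.length f x‖ := by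
  induction L generalizing f with
  | nil => simp [listDeriv]
  | cons i L ih => exact (ih (hf.pd i)).trans (norm_iteratedFDeriv_pd_le hf i)

lemma fderiv_eq_sum_pd (f : 𝔼 → ℝ) :
    fderiv ℝ f = fun x => ∑ i, pd i f x • (EuclideanSpace.proj i : 𝔼 →L[ℝ] ℝ) := by
  ext x v
  conv_lhs => rw [← (EuclideanSpace.basisFun (Fin d) ℝ).sum_repr v]
  simp [pd, mul_comm]

lemma norm_iteratedFDeriv_le_of_listDeriv_le {n : ℕ} {f : 𝔼 → ℝ} {x : 𝔼} {B : ℝ}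
    (hf : ContDiffAt ℝ n f x)
    (hB : ∀ L : List (Fin d), L.length = n → |listDeriv L f x| ≤ B) :
    ‖iteratedFDeriv ℝ n f x‖ ≤ (d : ℝ) ^ n * B := by
  induction n generalizing f with
  | zero => simpa [listDeriv] using hB [] rfl
  | succ n ih =>
    have hsum : iteratedFDeriv ℝ n (fderiv ℝ f) x =
        ∑ i, iteratedFDeriv ℝ n
          (fun y => pd i f y • (EuclideanSpace.proj i : 𝔼 →L[ℝ] ℝ)) x := by
      rw [fderiv_eq_sum_pd]
      exact iteratedFDeriv_fun_sum_apply fun i _ => (hf.pd i).smul contDiffAt_const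
    rw [← norm_iteratedFDeriv_fderiv, hsum]
    calc _ ≤ ∑ i : Fin d, (d : ℝ) ^ n * B := norm_sum_le_of_le _ fun i _ => by
          rw [iteratedFDeriv_smul_const_apply (hf.pd i)]
          refine (ContinuousLinearMap.norm_compContinuousMultilinearMap_le _ _).trans ?_
          refine (mul_le_of_le_one_left (norm_nonneg _) ?_).trans
            (ih (hf.pd i) fun L hL => hB (i :: L) (by simp [hL]))
          rw [ContinuousLinearMap.norm_smulRight_apply]
          refine mul_le_one₀ ContinuousLinearMap.norm_id_le (norm_nonneg _) ?_
          refine ContinuousLinearMap.opNorm_le_bound _ zero_le_one fun v => ?_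
          simpa using EuclideanSpace.norm_eq v ▸ PiLp.norm_apply_le v i
      _ = (d : ℝ) ^ (n + 1) * B := by simp; ring

lemma norm_iteratedFDeriv_le_of_multiDeriv_le {n : ℕ} {f : 𝔼 → ℝ} {x : 𝔼} {B : ℝ}
    (hf : ContDiffAt ℝ n f x)
    (hB : ∀ α : Fin d → ℕ, ∑ j, α j = n → |multiDeriv α f x| ≤ B) :
    ‖iteratedFDeriv ℝ n f x‖ ≤ (d : ℝ) ^ n * B := by
  refine norm_iteratedFDeriv_le_of_listDeriv_le hf fun L hL => ?_
  have hp := perm_multiIndexList L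
  rw [listDeriv_perm hp (by rwa [hL]), ← multiDeriv_eq_listDeriv]
  exact hB _ (by rw [← length_multiIndexList, ← hp.length_eq, hL])

end PartialDerivatives

section Convolution

variable {d : ℕ}

local notation "𝔼" => EuclideanSpace ℝ (Fin d)

/-- `f` is of class `C^n` and its derivatives up to order `n` are bounded. -/
def HasBoundedDerivs (n : ℕ) (f : 𝔼 → ℝ) : Prop :=
  ContDiff ℝ n f ∧ ∀ k ≤ n, ∃ C, ∀ x, ‖iteratedFDeriv ℝ k f x‖ ≤ C

lemma HasBoundedDerivs.pd {n : ℕ} {f : 𝔼 → ℝ} (hf : HasBoundedDerivs (n + 1) f) (i : Fin d) :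
    HasBoundedDerivs n (pd i f) := by
  refine ⟨hf.1.pd i, fun k hk => ?_⟩
  obtain ⟨C, hC⟩ := hf.2 (k + 1) (by lia)
  refine ⟨C, fun x => (norm_iteratedFDeriv_pd_le ?_ i).trans (hC x)⟩
  exact hf.1.contDiffAt.of_le (by exact_mod_cast Nat.succ_le_succ hk)

lemma HasBoundedDerivs.exists_abs_le {n : ℕ} {f : 𝔼 → ℝ} (hf : HasBoundedDerivs n f) :
    ∃ C, ∀ x, |f x| ≤ C := by
  simpa using hf.2 0 (Nat.zero_le _)

lemma HasBoundedDerivs.integrable_mul {n : ℕ} {f h : 𝔼 → ℝ} (hf : HasBoundedDerivs n f)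
    (hh : Integrable h) (x : 𝔼) : Integrable fun y => f (x - y) * h y := by
  obtain ⟨C, hC⟩ := hf.exists_abs_le
  refine hh.bdd_mul (c := C) ?_ (ae_of_all _ fun y => hC _)
  exact (hf.1.continuous.comp (by fun_prop)).aestronglyMeasurable

lemma HasBoundedDerivs.hasFDerivAt_integral {n : ℕ} {f h : 𝔼 → ℝ}
    (hf : HasBoundedDerivs (n + 1) f) (hh : Integrable h) (x : 𝔼) :
    Integrable (fun y => h y • fderiv ℝ f (x - y)) ∧
      HasFDerivAt (fun x => ∫ y, f (x - y) * h y) (∫ y, h y • fderiv ℝ f (x - y)) x := by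
  obtain ⟨C, hC⟩ := hf.2 1 (by lia)
  simp only [norm_iteratedFDeriv_one] at hC
  have hcont : Continuous (fderiv ℝ f) := hf.1.continuous_fderiv (by simp)
  have hmeas : AEStronglyMeasurable (fun y => h y • fderiv ℝ f (x - y)) :=
    hh.1.smul (hcont.comp (by fun_prop)).aestronglyMeasurable
  have hbound : ∀ (x y : 𝔼), ‖h y • fderiv ℝ f (x - y)‖ ≤ ‖h y‖ * C := fun x y => by
    rw [norm_smul]
    gcongr
    exact hC _
  refine ⟨(hh.norm.mul_const C).mono' hmeas (ae_of_all _ (hbound x)), ?_⟩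
  refine hasFDerivAt_integral_of_dominated_of_fderiv_le (s := Set.univ)
    (F' := fun x y => h y • fderiv ℝ f (x - y)) univ_mem
    (Eventually.of_forall fun x => (hf.integrable_mul hh x).1) (hf.integrable_mul hh x) hmeas
    (ae_of_all _ fun y x _ => hbound x y) (hh.norm.mul_const C) (ae_of_all _ fun y x _ => ?_)
  have hdiff : HasFDerivAt f (fderiv ℝ f (x - y)) (x - y) :=
    (hf.1.differentiable (by simp)).differentiableAt.hasFDerivAt
  exact ((hasFDerivAt_comp_sub y).2 hdiff).mul_const (h y)

lemma pd_integral_add_integral {n : ℕ} {f₁ h₁ f₂ h₂ : 𝔼 → ℝ}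
    (hf₁ : HasBoundedDerivs (n + 1) f₁) (hh₁ : Integrable h₁)
    (hf₂ : HasBoundedDerivs (n + 1) f₂) (hh₂ : Integrable h₂) (i : Fin d) :
    pd i (fun x => (∫ y, f₁ (x - y) * h₁ y) + ∫ y, f₂ (x - y) * h₂ y) =
      fun x => (∫ y, pd i f₁ (x - y) * h₁ y) + ∫ y, pd i f₂ (x - y) * h₂ y := by
  ext x
  obtain ⟨hi₁, hd₁⟩ := hf₁.hasFDerivAt_integral hh₁ x
  obtain ⟨hi₂, hd₂⟩ := hf₂.hasFDerivAt_integral hh₂ x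
  simp only [pd]
  rw [(hd₁.fun_add hd₂).fderiv, add_apply,
    ContinuousLinearMap.integral_apply hi₁, ContinuousLinearMap.integral_apply hi₂]
  simp [mul_comm]

lemma listDeriv_integral_add_integral {L : List (Fin d)} {f₁ h₁ f₂ h₂ : 𝔼 → ℝ}
    (hf₁ : HasBoundedDerivs L.length f₁) (hh₁ : Integrable h₁)
    (hf₂ : HasBoundedDerivs L.length f₂) (hh₂ : Integrable h₂) :
    listDeriv L (fun x => (∫ y, f₁ (x - y) * h₁ y) + ∫ y, f₂ (x - y) * h₂ y) =
      fun x => (∫ y, listDeriv L f₁ (x - y) * h₁ y) + ∫ y, listDeriv L f₂ (x - y) * h₂ y := by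
  induction L generalizing f₁ f₂ with
  | nil => rfl
  | cons i L ih =>
    simp only [listDeriv_cons]
    rw [pd_integral_add_integral hf₁ hh₁ hf₂ hh₂, ih (hf₁.pd i) (hf₂.pd i)]

end Convolution

section HeatKernel

variable {d : ℕ}

local notation "𝔼" => EuclideanSpace ℝ (Fin d)

lemma one_add_pow_mul_exp_le (N : ℕ) {r : ℝ} (hr : 0 ≤ r) :
    (1 + r) ^ N * Real.exp (-r ^ 2 / 4) ≤ N.factorial * Real.exp 2 := by
  have h1 : (1 + r) ^ N ≤ N.factorial * Real.exp (1 + r) := by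
    have := Real.pow_div_factorial_le_exp (1 + r) (by positivity) N
    rwa [div_le_iff₀' (by positivity)] at this
  calc (1 + r) ^ N * Real.exp (-r ^ 2 / 4)
      ≤ N.factorial * Real.exp (1 + r) * Real.exp (-r ^ 2 / 4) := by gcongr
    _ = N.factorial * Real.exp (1 + r + -r ^ 2 / 4) := by rw [mul_assoc, ← Real.exp_add]
    _ ≤ N.factorial * Real.exp 2 := by
      gcongr
      nlinarith [sq_nonneg (r - 2)]

variable (d) in
lemma exists_norm_iteratedFDeriv_exp_neg_norm_sq_le (N k : ℕ) :
    ∃ C, 0 ≤ C ∧ ∀ z : 𝔼, (1 + ‖z‖) ^ N *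
      ‖iteratedFDeriv ℝ k (fun z : 𝔼 => Real.exp (-‖z‖ ^ 2 / 4)) z‖ ≤ C := by
  have hq : (fun z : 𝔼 => -‖z‖ ^ 2 / 4).HasTemperateGrowth := by
    have h : (fun z : 𝔼 => -‖z‖ ^ 2 / 4) = fun z => (-1 / 4) * ‖z‖ ^ 2 := by ext; ring
    rw [h]
    exact (Function.HasTemperateGrowth.const _).mul (Function.hasTemperateGrowth_norm_sq 𝔼)
  obtain ⟨p, C₀, hC₀, hp⟩ := hq.norm_iteratedFDeriv_le_uniform k
  set C₁ := max 1 C₀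
  have hC₁ : 1 ≤ C₁ := le_max_left _ _
  refine ⟨k.factorial * C₁ ^ k * ((N + p * k).factorial * Real.exp 2), by positivity, fun z => ?_⟩
  have hD : 1 ≤ C₁ * (1 + ‖z‖) ^ p :=
    one_le_mul_of_one_le_of_one_le hC₁ (one_le_pow₀ (by simp))
  have key := norm_iteratedFDeriv_comp_le (n := k) (N := k) (Real.contDiff_exp (n := k))
    (hq.1.of_le (by exact_mod_cast le_top)) le_rfl z (C := Real.exp (-‖z‖ ^ 2 / 4))
    (D := C₁ * (1 + ‖z‖) ^ p)
    (fun i _ => by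
      rw [norm_iteratedFDeriv_eq_norm_iteratedDeriv, iteratedDeriv_eq_iterate,
        Real.iter_deriv_exp, Real.norm_of_nonneg (Real.exp_nonneg _)])
    (fun i hi hik => calc
      _ ≤ C₀ * (1 + ‖z‖) ^ p := hp i hik z
      _ ≤ C₁ * (1 + ‖z‖) ^ p := by gcongr; exact le_max_right _ _
      _ ≤ _ := le_self_pow₀ hD (by lia))
  calc _ ≤ (1 + ‖z‖) ^ N * (k.factorial * Real.exp (-‖z‖ ^ 2 / 4) * (C₁ * (1 + ‖z‖) ^ p) ^ k) := by
        gcongr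
        exact key
    _ = k.factorial * C₁ ^ k * ((1 + ‖z‖) ^ (N + p * k) * Real.exp (-‖z‖ ^ 2 / 4)) := by
        rw [mul_pow, ← pow_mul, pow_add]; ring
    _ ≤ _ := by
        refine mul_le_mul_of_nonneg_left ?_ (by positivity)
        exact one_add_pow_mul_exp_le _ (norm_nonneg _)

lemma heatKernel_eq_smul {t : ℝ} (ht : 0 < t) :
    heatKernel d t = fun z : 𝔼 => ((4 * Real.pi) ^ (-(d : ℝ) / 2) * (√t)⁻¹ ^ d) •
      Real.exp (-‖(√t)⁻¹ • z‖ ^ 2 / 4) := by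
  ext z
  have h1 : (4 * Real.pi * t) ^ (-(d : ℝ) / 2) =
      (4 * Real.pi) ^ (-(d : ℝ) / 2) * (√t)⁻¹ ^ d := by
    rw [Real.mul_rpow (by positivity) ht.le, Real.sqrt_eq_rpow, ← Real.rpow_neg ht.le,
      ← Real.rpow_natCast, ← Real.rpow_mul ht.le]
    congr 2
    ring
  have h2 : ‖(√t)⁻¹ • z‖ ^ 2 = ‖z‖ ^ 2 / t := by
    rw [norm_smul, mul_pow, Real.norm_eq_abs, sq_abs, inv_pow, Real.sq_sqrt ht.le]
    field_simp
  rw [heatKernel, h1, h2, smul_eq_mul]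
  congr 2
  field_simp

lemma contDiff_heatKernel {t : ℝ} {n : WithTop ℕ∞} : ContDiff ℝ n (heatKernel d t) := by
  unfold heatKernel
  exact contDiff_const.mul (((contDiff_norm_sq ℝ).neg.div_const _).exp)

variable (d) in
lemma exists_norm_iteratedFDeriv_heatKernel_le (k : ℕ) :
    ∃ C, 0 ≤ C ∧ ∀ t : ℝ, 0 < t → ∀ z : 𝔼,
      ‖iteratedFDeriv ℝ k (heatKernel d t) z‖ * (√t + ‖z‖) ^ (d + k) ≤ C := by
  obtain ⟨C, hC0, hC⟩ := exists_norm_iteratedFDeriv_exp_neg_norm_sq_le d (d + k) k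
  refine ⟨(4 * Real.pi) ^ (-(d : ℝ) / 2) * C, by positivity, fun t ht z => ?_⟩
  have hG : ContDiff ℝ k (fun z : 𝔼 => Real.exp (-‖z‖ ^ 2 / 4)) :=
    ((contDiff_norm_sq ℝ).neg.div_const _).exp
  have hs : 0 < √t := Real.sqrt_pos.2 ht
  have hz : √t + ‖z‖ = √t * (1 + ‖(√t)⁻¹ • z‖) := by
    rw [norm_smul, norm_inv, Real.norm_of_nonneg hs.le]
    field_simp
  have hG' : ContDiff ℝ k (fun z : 𝔼 => Real.exp (-‖(√t)⁻¹ • z‖ ^ 2 / 4)) :=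
    hG.comp (contDiff_const_smul (√t)⁻¹)
  rw [heatKernel_eq_smul ht, iteratedFDeriv_const_smul_apply' hG'.contDiffAt,
    iteratedFDeriv_comp_const_smul _ hG, hz, norm_smul, norm_smul, mul_pow,
    Real.norm_of_nonneg (by positivity), Real.norm_of_nonneg (by positivity)]
  have hcancel : (√t)⁻¹ ^ d * (√t)⁻¹ ^ k * √t ^ (d + k) = 1 := by
    rw [← pow_add, ← mul_pow, inv_mul_cancel₀ hs.ne', one_pow]
  refine le_of_eq_of_le ?_ (mul_le_mul_of_nonneg_left (hC ((√t)⁻¹ • z)) (by positivity))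
  generalize ‖iteratedFDeriv ℝ k (fun z : 𝔼 => Real.exp (-‖z‖ ^ 2 / 4)) ((√t)⁻¹ • z)‖ = A
  linear_combination (4 * Real.pi) ^ (-(d : ℝ) / 2) * (1 + ‖(√t)⁻¹ • z‖) ^ (d + k) * A * hcancel

lemma hasBoundedDerivs_heatKernel {t : ℝ} (ht : 0 < t) (n : ℕ) :
    HasBoundedDerivs n (heatKernel d t) := by
  refine ⟨contDiff_heatKernel, fun k _ => ?_⟩
  obtain ⟨C, hC0, hC⟩ := exists_norm_iteratedFDeriv_heatKernel_le d k
  have hs : 0 < √t := Real.sqrt_pos.2 ht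
  refine ⟨C / √t ^ (d + k), fun z => ?_⟩
  rw [le_div_iff₀ (by positivity)]
  refine le_trans ?_ (hC t ht z)
  gcongr
  simp

lemma heatKernel_nonneg {t : ℝ} (ht : 0 < t) (z : 𝔼) : 0 ≤ heatKernel d t z := by
  unfold heatKernel; positivity

lemma integral_heatKernel {t : ℝ} (ht : 0 < t) : ∫ z : 𝔼, heatKernel d t z = 1 := by
  have h : ∀ z : 𝔼, heatKernel d t z =
      (4 * Real.pi * t) ^ (-(d : ℝ) / 2) * Real.exp (-(4 * t)⁻¹ * ‖z‖ ^ 2) := fun z => by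
    rw [heatKernel]; congr 2; field_simp
  simp only [h]
  rw [integral_const_mul, GaussianFourier.integral_rexp_neg_mul_sq_norm (by positivity),
    finrank_euclideanSpace_fin, div_inv_eq_mul, neg_div, Real.rpow_neg (by positivity),
    show Real.pi * (4 * t) = 4 * Real.pi * t by ring]
  exact inv_mul_cancel₀ (by positivity)

lemma integrable_heatKernel {t : ℝ} (ht : 0 < t) : Integrable (heatKernel d t) :=
  Integrable.of_integral_ne_zero (by rw [integral_heatKernel ht]; exact one_ne_zero)

end HeatKernel

section Cutoff

open scoped ContDiff

variable {d : ℕ}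

local notation "𝔼" => EuclideanSpace ℝ (Fin d)

variable (d) in
/-- A smooth function that vanishes near the origin, equals `1` away from it, and has bounded
derivatives of every order. -/
structure IsCutoff (χ : 𝔼 → ℝ) : Prop where
  smooth : ContDiff ℝ ∞ χ
  eq_zero : ∀ y, ‖y‖ ≤ 1 / 8 → χ y = 0
  eq_one : ∀ y, 1 / 4 ≤ ‖y‖ → χ y = 1
  nonneg : ∀ y, 0 ≤ χ y
  le_one : ∀ y, χ y ≤ 1
  bounded : ∀ k : ℕ, ∃ C, ∀ y, ‖iteratedFDeriv ℝ k χ y‖ ≤ C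

variable (d) in
lemma exists_isCutoff : ∃ χ : 𝔼 → ℝ, IsCutoff d χ := by
  let b : ContDiffBump (0 : 𝔼) := ⟨1 / 8, 1 / 4, by norm_num, by norm_num⟩
  refine ⟨fun y => 1 - b y, contDiff_const.sub b.contDiff, fun y hy => ?_, fun y hy => ?_,
    fun y => sub_nonneg.2 b.le_one, fun y => sub_le_self _ b.nonneg, fun k => ?_⟩
  · rw [b.one_of_mem_closedBall (by simpa [b] using hy), sub_self]
  · rw [b.zero_of_le_dist (by simpa [b] using hy), sub_zero]
  · have hb : ContDiff ℝ k (b : 𝔼 → ℝ) := b.contDiff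
    obtain ⟨C, hC⟩ := (b.hasCompactSupport.iteratedFDeriv (𝕜 := ℝ) k).exists_bound_of_continuous
      (hb.continuous_iteratedFDeriv le_rfl)
    refine ⟨1 + C, fun y => ?_⟩
    have h := iteratedFDeriv_sub_apply (𝕜 := ℝ) (i := k) (x := y)
      (f := fun _ : 𝔼 => (1 : ℝ)) contDiffAt_const hb.contDiffAt
    change ‖iteratedFDeriv ℝ k ((fun _ => 1) - ⇑b) y‖ ≤ _
    rw [h]
    refine (norm_sub_le _ _).trans (add_le_add ?_ (hC y))
    rcases eq_or_ne k 0 with rfl | hk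
    · simp
    · simp [iteratedFDeriv_const_of_ne hk]

lemma norm_inv_smul {R : ℝ} (hR : 0 < R) (y : 𝔼) : ‖R⁻¹ • y‖ = ‖y‖ / R := by
  rw [norm_smul, norm_inv, Real.norm_of_nonneg hR.le, inv_mul_eq_div]

lemma contDiff_of_isCutoff {χ : 𝔼 → ℝ} (hχ : IsCutoff d χ) (n : ℕ) : ContDiff ℝ n χ :=
  contDiff_infty.1 hχ.smooth n

lemma contDiff_isCutoff_mul {χ : 𝔼 → ℝ} (hχ : IsCutoff d χ) {n : ℕ} {R : ℝ} (hR : 0 < R)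
    {a : 𝔼 → ℝ} (ha : ContDiffOn ℝ n a {0}ᶜ) : ContDiff ℝ n fun y => χ (R⁻¹ • y) * a y := by
  refine contDiff_iff_contDiffAt.2 fun y => ?_
  rcases eq_or_ne y 0 with rfl | hy
  · refine (contDiffAt_const (c := (0 : ℝ))).congr_of_eventuallyEq ?_
    filter_upwards [Metric.ball_mem_nhds (0 : 𝔼) (show 0 < R / 8 by positivity)] with z hz
    rw [hχ.eq_zero, zero_mul]
    rw [norm_inv_smul hR, div_le_iff₀ hR]
    linarith [mem_ball_zero_iff.1 hz]
  · refine ContDiffAt.mul ?_ (ha.contDiffAt (isOpen_compl_singleton.mem_nhds hy))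
    exact ((contDiff_of_isCutoff hχ n).comp (contDiff_const_smul R⁻¹)).contDiffAt

lemma exists_norm_iteratedFDeriv_isCutoff_mul_le {χ : 𝔼 → ℝ} (hχ : IsCutoff d χ) {θ : ℝ}
    (hθ : 0 ≤ θ) (k : ℕ) : ∃ C, 0 ≤ C ∧ ∀ (a : 𝔼 → ℝ) (M R : ℝ), 0 ≤ M → 0 < R →
      ContDiffOn ℝ k a {0}ᶜ →
      (∀ j ≤ k, ∀ y, y ≠ 0 → ‖iteratedFDeriv ℝ j a y‖ ≤ M * ‖y‖ ^ (-(θ + j))) →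
      ∀ y, ‖iteratedFDeriv ℝ k (fun y => χ (R⁻¹ • y) * a y) y‖ ≤ C * M * R ^ (-(θ + k)) := by
  choose c hc using hχ.bounded
  have hc0 : ∀ i, 0 ≤ c i := fun i => (norm_nonneg _).trans (hc i 0)
  refine ⟨∑ i ∈ Finset.range (k + 1), (k.choose i : ℝ) * c i * 8 ^ (θ + (k - i : ℕ)),
    Finset.sum_nonneg fun i _ => mul_nonneg (mul_nonneg (by positivity) (hc0 i)) (by positivity),
    fun a M R hM hR ha haM y => ?_⟩
  rcases lt_or_ge ‖y‖ (R / 8) with hy | hy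
  · have h0 : (fun y => χ (R⁻¹ • y) * a y) =ᶠ[𝓝 y] fun _ => 0 := by
      filter_upwards [(continuous_norm.tendsto y).eventually (gt_mem_nhds hy)] with z hz
      rw [hχ.eq_zero, zero_mul]
      rw [norm_inv_smul hR, div_le_iff₀ hR]
      linarith
    rw [(h0.iteratedFDeriv ℝ k).eq_of_nhds, iteratedFDeriv_fun_zero]
    simp only [Pi.zero_apply, norm_zero]
    have := Finset.sum_nonneg (s := Finset.range (k + 1)) (f := fun i =>
      (k.choose i : ℝ) * c i * (8 : ℝ) ^ (θ + (k - i : ℕ))) fun i _ =>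
        mul_nonneg (mul_nonneg (by positivity) (hc0 i)) (by positivity)
    positivity
  have hy0 : y ≠ 0 := norm_pos_iff.1 (lt_of_lt_of_le (by positivity) hy)
  have hopen : IsOpen ({0}ᶜ : Set 𝔼) := isOpen_compl_singleton
  have hleib := norm_iteratedFDerivWithin_mul_le (𝕜 := ℝ) (n := k) (N := k)
    (f := fun y => χ (R⁻¹ • y))
    ((contDiff_of_isCutoff hχ k).comp (contDiff_const_smul R⁻¹)).contDiffOn ha
    hopen.uniqueDiffOn hy0 le_rfl
  simp only [iteratedFDerivWithin_of_isOpen _ hopen hy0] at hleib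
  refine hleib.trans ?_
  rw [Finset.sum_mul, Finset.sum_mul]
  refine Finset.sum_le_sum fun i hi => ?_
  have hik : i ≤ k := Nat.lt_succ_iff.1 (Finset.mem_range.1 hi)
  have h1 : ‖iteratedFDeriv ℝ i (fun y => χ (R⁻¹ • y)) y‖ ≤ R⁻¹ ^ i * c i := by
    rw [iteratedFDeriv_comp_const_smul _ (contDiff_of_isCutoff hχ i), norm_smul,
      Real.norm_of_nonneg (by positivity)]
    gcongr
    exact hc i _
  have h2 : ‖iteratedFDeriv ℝ (k - i) a y‖ ≤
      M * (8 ^ (θ + (k - i : ℕ)) * R ^ (-(θ + (k - i : ℕ)))) := by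
    refine (haM _ (Nat.sub_le _ _) y hy0).trans ?_
    gcongr
    calc ‖y‖ ^ (-(θ + (k - i : ℕ))) ≤ (R / 8) ^ (-(θ + (k - i : ℕ))) :=
          Real.rpow_le_rpow_of_nonpos (by positivity) hy (by
            rw [Left.neg_nonpos_iff]; positivity)
      _ = _ := by
        rw [Real.div_rpow hR.le (by norm_num), Real.rpow_neg (by norm_num : (0 : ℝ) ≤ 8),
          div_inv_eq_mul, mul_comm]
  have h3 : R⁻¹ ^ i * R ^ (-(θ + (k - i : ℕ))) = R ^ (-(θ + k)) := by
    rw [inv_pow, ← Real.rpow_natCast, ← Real.rpow_neg hR.le, ← Real.rpow_add hR,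
      Nat.cast_sub hik]
    congr 1
    ring
  calc _ ≤ (k.choose i : ℝ) * (R⁻¹ ^ i * c i) *
        (M * (8 ^ (θ + (k - i : ℕ)) * R ^ (-(θ + (k - i : ℕ))))) := by
        have := hc0 i
        gcongr
    _ = (k.choose i : ℝ) * c i * 8 ^ (θ + (k - i : ℕ)) * M *
        (R⁻¹ ^ i * R ^ (-(θ + (k - i : ℕ)))) := by ring
    _ = _ := by rw [h3]

end Cutoff

section LocalIntegral

variable {d : ℕ}

local notation "𝔼" => EuclideanSpace ℝ (Fin d)

variable (d) in
lemma exists_integral_norm_le_of_norm_le_rpow (hd : 1 ≤ d) {θ : ℝ} (hθd : θ < d) :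
    ∃ C, 0 ≤ C ∧ ∀ (b : 𝔼 → ℝ) (M R : ℝ), 0 ≤ M → 0 < R → AEStronglyMeasurable b →
      (∀ y, y ≠ 0 → |b y| ≤ M * ‖y‖ ^ (-θ)) → (∀ y, R ≤ ‖y‖ → b y = 0) →
      Integrable b ∧ ∫ y, |b y| ≤ C * M * R ^ (d - θ) := by
  have : Nonempty (Fin d) := ⟨⟨0, hd⟩⟩
  let F : 𝔼 → ℝ := (Metric.ball 0 1).indicator fun y => ‖y‖ ^ (-θ)
  have hF : Integrable F := by
    rw [integrable_indicator_iff measurableSet_ball]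
    refine integrableOn_ball_of_norm_le_rpow (C := 1) (α := θ) (by simpa) (by simpa) ?_ ?_
    · refine ae_of_all _ fun y => ?_
      rw [one_mul, Real.norm_of_nonneg (by positivity)]
    · exact (measurable_norm.pow_const _).aestronglyMeasurable
  have hF0 : ∀ y, 0 ≤ F y := fun y => Set.indicator_nonneg (fun _ _ => by positivity) _
  refine ⟨∫ y, F y, integral_nonneg hF0, fun b M R hM hR hb hbM hb0 => ?_⟩
  have hscale : Integrable fun y => M * R ^ (-θ) * F (R⁻¹ • y) :=
    (hF.comp_smul (inv_ne_zero hR.ne')).const_mul _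
  have hle : ∀ᵐ y : 𝔼, |b y| ≤ M * R ^ (-θ) * F (R⁻¹ • y) := by
    filter_upwards [compl_mem_ae_iff.2 (measure_singleton (0 : 𝔼))] with y hy
    rcases lt_or_ge ‖y‖ R with h | h
    · have hmem : R⁻¹ • y ∈ Metric.ball (0 : 𝔼) 1 := by
        rw [mem_ball_zero_iff, norm_inv_smul hR]
        exact (div_lt_one hR).2 h
      simp only [F]
      rw [Set.indicator_of_mem hmem, norm_inv_smul hR, mul_assoc, ← Real.mul_rpow hR.le
        (by positivity), mul_div_cancel₀ _ hR.ne']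
      exact hbM y hy
    · rw [hb0 y h, abs_zero]
      have := hF0 (R⁻¹ • y)
      positivity
  refine ⟨hscale.mono' hb hle, ?_⟩
  calc ∫ y, |b y| ≤ ∫ y, M * R ^ (-θ) * F (R⁻¹ • y) :=
        integral_mono_of_nonneg (ae_of_all _ fun _ => abs_nonneg _) hscale hle
    _ = M * R ^ (-θ) * (R ^ d * ∫ y, F y) := by
        rw [integral_const_mul, Measure.integral_comp_inv_smul_of_nonneg _ _ hR.le,
          finrank_euclideanSpace_fin, smul_eq_mul]
    _ = _ := by
        rw [sub_eq_neg_add, Real.rpow_add hR, Real.rpow_natCast]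
        ring

end LocalIntegral
section HeatBound

variable {d : ℕ}

local notation "𝔼" => EuclideanSpace ℝ (Fin d)

lemma hasBoundedDerivs_isCutoff_mul {χ : 𝔼 → ℝ} (hχ : IsCutoff d χ) {θ : ℝ} (hθ : 0 ≤ θ) {n : ℕ}
    {a : 𝔼 → ℝ} {M R : ℝ} (hM : 0 ≤ M) (hR : 0 < R) (ha : ContDiffOn ℝ n a {0}ᶜ)
    (haM : ∀ j ≤ n, ∀ y, y ≠ 0 → ‖iteratedFDeriv ℝ j a y‖ ≤ M * ‖y‖ ^ (-(θ + j))) :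
    HasBoundedDerivs n fun y => χ (R⁻¹ • y) * a y := by
  refine ⟨contDiff_isCutoff_mul hχ hR ha, fun k hk => ?_⟩
  obtain ⟨C, -, hC⟩ := exists_norm_iteratedFDeriv_isCutoff_mul_le hχ hθ k
  exact ⟨_, hC a M R hM hR (ha.of_le (by exact_mod_cast hk)) fun j hj => haM j (hj.trans hk)⟩

lemma heat_eq_integral_add_integral {t : ℝ} (ht : 0 < t) {a b₁ b₂ : 𝔼 → ℝ}
    (hb₁ : Integrable b₁) {n : ℕ} (hb₂ : HasBoundedDerivs n b₂) (hab : ∀ y, a y = b₁ y + b₂ y) :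
    heat d t a = fun x => (∫ y, heatKernel d t (x - y) * b₁ y) +
      ∫ y, b₂ (x - y) * heatKernel d t y := by
  funext x
  have h₁ := (hasBoundedDerivs_heatKernel ht 0).integrable_mul hb₁ x
  have h₂ := hb₂.integrable_mul (integrable_heatKernel ht) x
  have h₂' : Integrable fun y => heatKernel d t (x - y) * b₂ y := by
    simpa [mul_comm] using h₂.comp_sub_left x
  have hswap : ∫ y, b₂ (x - y) * heatKernel d t y = ∫ y, heatKernel d t (x - y) * b₂ y := by
    rw [← integral_sub_left_eq_self (fun y => b₂ (x - y) * heatKernel d t y) volume x]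
    simp [mul_comm]
  rw [hswap, ← integral_add h₁ h₂']
  simp only [heat, hab, mul_add]

lemma aestronglyMeasurable_of_continuousOn_compl_zero (hd : 1 ≤ d) {a : 𝔼 → ℝ}
    (ha : ContinuousOn a {0}ᶜ) : AEStronglyMeasurable a := by
  have : Nonempty (Fin d) := ⟨⟨0, hd⟩⟩
  have h := ha.aestronglyMeasurable (μ := volume) (measurableSet_singleton (0 : 𝔼)).compl
  have hae : ∀ᵐ y : 𝔼, y ∈ ({0}ᶜ : Set 𝔼) := compl_mem_ae_iff.2 (measure_singleton 0)
  rwa [Measure.restrict_eq_self_of_ae_mem hae] at h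

variable (d) in
lemma exists_abs_listDeriv_heat_le (hd : 1 ≤ d) {θ : ℝ} (hθ : 0 ≤ θ) (hθd : θ < d) (k : ℕ) :
    ∃ C, 0 ≤ C ∧ ∀ (a : 𝔼 → ℝ) (M : ℝ), 0 ≤ M → ContDiffOn ℝ k a {0}ᶜ →
      (∀ j ≤ k, ∀ y, y ≠ 0 → ‖iteratedFDeriv ℝ j a y‖ ≤ M * ‖y‖ ^ (-(θ + j))) →
      ∀ t, 0 < t → ∀ (x : 𝔼) (L : List (Fin d)), L.length = k →
        |listDeriv L (heat d t a) x| ≤ C * M * (√t + ‖x‖) ^ (-(θ + k)) := by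
  obtain ⟨χ, hχ⟩ := exists_isCutoff d
  obtain ⟨Cχ, hCχ0, hCχ⟩ := exists_norm_iteratedFDeriv_isCutoff_mul_le hχ hθ k
  obtain ⟨Cg, hCg0, hCg⟩ := exists_norm_iteratedFDeriv_heatKernel_le d k
  obtain ⟨Cb, hCb0, hCb⟩ := exists_integral_norm_le_of_norm_le_rpow d hd hθd
  refine ⟨2 ^ (d + k) * Cg * (Cb * (1 / 4) ^ (d - θ)) + Cχ, by positivity,
    fun a M hM ha haM t ht x L hL => ?_⟩
  set R := √t + ‖x‖ with hRdef
  have hR : 0 < R := add_pos_of_pos_of_nonneg (Real.sqrt_pos.2 ht) (norm_nonneg x)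
  let b₁ : 𝔼 → ℝ := fun y => (1 - χ (R⁻¹ • y)) * a y
  let b₂ : 𝔼 → ℝ := fun y => χ (R⁻¹ • y) * a y
  have hb₁0 : ∀ y, R / 4 ≤ ‖y‖ → b₁ y = 0 := fun y hy => by
    have : χ (R⁻¹ • y) = 1 := hχ.eq_one _ (by
      rw [norm_inv_smul hR, le_div_iff₀ hR]; linarith)
    simp [b₁, this]
  have hb₁M : ∀ y, y ≠ 0 → |b₁ y| ≤ M * ‖y‖ ^ (-θ) := fun y hy => by
    have h0 : |a y| ≤ M * ‖y‖ ^ (-θ) := by simpa using haM 0 (Nat.zero_le _) y hy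
    have h1 := hχ.nonneg (R⁻¹ • y)
    have h2 := hχ.le_one (R⁻¹ • y)
    rw [abs_mul, abs_of_nonneg (sub_nonneg.2 h2)]
    exact (mul_le_of_le_one_left (abs_nonneg _) (by linarith)).trans h0
  have hb₁m : AEStronglyMeasurable b₁ := by
    refine AEStronglyMeasurable.mul (Continuous.aestronglyMeasurable ?_)
      (aestronglyMeasurable_of_continuousOn_compl_zero hd ha.continuousOn)
    exact continuous_const.sub (hχ.smooth.continuous.comp (continuous_const_smul _))
  obtain ⟨hb₁i, hb₁n⟩ := hCb b₁ M (R / 4) hM (by positivity) hb₁m hb₁M hb₁0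
  have hb₂ : HasBoundedDerivs k b₂ := hasBoundedDerivs_isCutoff_mul hχ hθ hM hR ha haM
  rw [heat_eq_integral_add_integral ht hb₁i hb₂ fun y => by simp only [b₁, b₂]; ring,
    listDeriv_integral_add_integral (hasBoundedDerivs_heatKernel ht _) hb₁i (hL ▸ hb₂)
      (integrable_heatKernel ht)]
  have hfar : |∫ y, listDeriv L (heatKernel d t) (x - y) * b₁ y| ≤
      2 ^ (d + k) * Cg * (Cb * (1 / 4) ^ (d - θ)) * M * R ^ (-(θ + k)) := by
    have hpt : ∀ y, ‖listDeriv L (heatKernel d t) (x - y) * b₁ y‖ ≤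
        Cg / (R / 2) ^ (d + k) * |b₁ y| := fun y => by
      rcases lt_or_ge ‖y‖ (R / 4) with hy | hy
      · rw [norm_mul, Real.norm_eq_abs, Real.norm_eq_abs]
        refine mul_le_mul_of_nonneg_right ?_ (abs_nonneg _)
        refine (abs_listDeriv_le (hasBoundedDerivs_heatKernel ht _).1.contDiffAt).trans ?_
        rw [hL, le_div_iff₀ (by positivity)]
        refine le_trans ?_ (hCg t ht (x - y))
        have h1 : R / 2 ≤ √t + ‖x - y‖ := by
          have := norm_sub_norm_le x y
          linarith
        gcongr
      · simp [hb₁0 y hy]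
    have h1 : |∫ y, listDeriv L (heatKernel d t) (x - y) * b₁ y| ≤
        Cg / (R / 2) ^ (d + k) * ∫ y, |b₁ y| := by
      rw [← integral_const_mul]
      exact norm_integral_le_of_norm_le (hb₁i.abs.const_mul _) (ae_of_all _ hpt)
    refine h1.trans ((mul_le_mul_of_nonneg_left hb₁n (by positivity)).trans_eq ?_)
    have h2 : R ^ (d - θ) = R ^ (-(θ + k)) * R ^ (d + k) := by
      rw [← Real.rpow_natCast, ← Real.rpow_add hR]
      congr 1
      push_cast
      ring
    rw [show R / 4 = 1 / 4 * R by ring, Real.mul_rpow (by norm_num) hR.le, h2, div_pow]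
    field_simp
  have hnear : |∫ y, listDeriv L b₂ (x - y) * heatKernel d t y| ≤ Cχ * M * R ^ (-(θ + k)) := by
    have hpt : ∀ y, ‖listDeriv L b₂ (x - y) * heatKernel d t y‖ ≤
        Cχ * M * R ^ (-(θ + k)) * heatKernel d t y := fun y => by
      rw [norm_mul, Real.norm_of_nonneg (heatKernel_nonneg ht y)]
      refine mul_le_mul_of_nonneg_right ?_ (heatKernel_nonneg ht y)
      refine (abs_listDeriv_le (hL ▸ hb₂).1.contDiffAt).trans ?_
      rw [hL]
      exact hCχ a M R hM hR ha haM (x - y)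
    have h1 := norm_integral_le_of_norm_le ((integrable_heatKernel ht).const_mul _)
      (ae_of_all _ hpt)
    rwa [integral_const_mul, integral_heatKernel ht, mul_one] at h1
  refine (abs_add_le _ _).trans ((add_le_add hfar hnear).trans_eq ?_)
  ring

end HeatBound

theorem stmt_13 (d m : ℕ) (hd : 1 ≤ d) (hm : 1 ≤ m) (θ : ℝ) (hθ0 : 0 ≤ θ) (hθd : θ < d) :
    ∃ C : ℝ, 0 < C ∧
      ∀ (a : EuclideanSpace ℝ (Fin d) → ℝ) (M : ℝ),
        ContDiffOn ℝ m a {(0 : EuclideanSpace ℝ (Fin d))}ᶜ →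
        (∀ α : Fin d → ℕ, (∑ j, α j) ≤ m → ∀ x : EuclideanSpace ℝ (Fin d), x ≠ 0 →
          |multiDeriv α a x| ≤ M * ‖x‖ ^ (-(θ + ((∑ j, α j : ℕ) : ℝ)))) →
        ∀ (t : ℝ), 0 < t → ∀ (x : EuclideanSpace ℝ (Fin d)),
          ∀ α : Fin d → ℕ, (∑ j, α j) ≤ m →
            |multiDeriv α (heat d t a) x| ≤
              C * M * (Real.sqrt t + ‖x‖) ^ (-(θ + ((∑ j, α j : ℕ) : ℝ))) := by
  choose c hc0 hc using exists_abs_listDeriv_heat_le d hd hθ0 hθd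
  have hd' : (1 : ℝ) ≤ d := by exact_mod_cast hd
  refine ⟨1 + (∑ k ∈ Finset.range (m + 1), c k) * d ^ m,
    add_pos_of_pos_of_nonneg one_pos
      (mul_nonneg (Finset.sum_nonneg fun k _ => hc0 k) (by positivity)), ?_⟩
  intro a M ha haM t ht x α hα
  have hM : 0 ≤ M := by
    have h := haM 0 (by simp) (EuclideanSpace.single ⟨0, hd⟩ 1) (by simp)
    simpa using (abs_nonneg _).trans h
  have hbound : ∀ j ≤ ∑ i, α i, ∀ y, y ≠ 0 →
      ‖iteratedFDeriv ℝ j a y‖ ≤ d ^ m * M * ‖y‖ ^ (-(θ + j)) := fun j hj y hy => by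
    have hay : ContDiffAt ℝ j a y := ((ha.of_le (by exact_mod_cast hj.trans hα)).contDiffAt
      (isOpen_compl_singleton.mem_nhds hy))
    refine (norm_iteratedFDeriv_le_of_multiDeriv_le hay (B := M * ‖y‖ ^ (-(θ + j)))
      fun β hβ => ?_).trans ?_
    · simpa only [hβ] using haM β (hβ.trans_le (hj.trans hα)) y hy
    · rw [← mul_assoc]
      have := pow_le_pow_right₀ hd' (hj.trans hα)
      gcongr
  have key := hc (∑ i, α i) a (d ^ m * M) (by positivity) (ha.of_le (by exact_mod_cast hα)) hbound
    t ht x (multiIndexList α) (length_multiIndexList α)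
  rw [multiDeriv_eq_listDeriv]
  refine key.trans ?_
  rw [← mul_assoc]
  have hle : c (∑ i, α i) ≤ ∑ k ∈ Finset.range (m + 1), c k :=
    Finset.single_le_sum (fun k _ => hc0 k) (Finset.mem_range.2 (Nat.lt_succ_of_le hα))
  have hle' : c (∑ i, α i) * d ^ m ≤ 1 + (∑ k ∈ Finset.range (m + 1), c k) * d ^ m := by
    have := mul_le_mul_of_nonneg_right hle (by positivity : (0 : ℝ) ≤ d ^ m)
    linarith
  gcongr
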